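/- Let k ≥ 2 be an integer, let ν(k) denote the 2-adic valuation of k, and let y be a positive integer with y ≤ 2^{2m+2n+1} for some positive integers m, n. Set λ := 1 + 1/(2(k−1)). Then there exists N₀ such that for every integer N ≥ N₀, for every integer r with 1 ≤ r ≤ k − 1, and for every integer j with 0 ≤ j ≤ 2^{⌊λN⌋}, one has t((y·2^{kN−ν(k)} + j)^r) = t((y·2^{kN−ν(k)+1} + j)^r). -/

import Mathlib

/-- The Thue–Morse indicator: `thueMorse n = 1` if the number of ones in the
binary expansion of `n` is odd, and `0` if it is even. -/
def thueMorse (n : ℕ) : ℕ := (Nat.digits 2 n).sum % 2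

theorem tm_rec (n : ℕ) : (Nat.digits 2 n).sum = n % 2 + (Nat.digits 2 (n / 2)).sum := by
  rcases Nat.eq_zero_or_pos n with h | h
  · subst h; simp
  · rw [Nat.digits_def' (by norm_num) h]; simp

theorem tm_block (s : ℕ) : ∀ a b : ℕ, a < 2 ^ s →
    (Nat.digits 2 (a + 2 ^ s * b)).sum = (Nat.digits 2 a).sum + (Nat.digits 2 b).sum := by
  induction s with
  | zero => intro a b h; have : a = 0 := by simpa using h
            subst this; simp
  | succ s ih =>
    intro a b h
    rw [tm_rec (a + _), tm_rec a]
    have e : a + 2 ^ (s + 1) * b = a + 2 * (2 ^ s * b) := by ring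
    have h1 : (a + 2 ^ (s + 1) * b) % 2 = a % 2 := by rw [e]; omega
    have h2 : (a + 2 ^ (s + 1) * b) / 2 = a / 2 + 2 ^ s * b := by rw [e]; omega
    rw [h1, h2, ih (a / 2) b (by rw [pow_succ] at h; omega)]
    ring

theorem tm_sum (s : ℕ) (n : ℕ) : ∀ c : ℕ → ℕ, (∀ i < n, c i < 2 ^ s) →
    (Nat.digits 2 (∑ i ∈ Finset.range n, c i * (2 ^ s) ^ i)).sum
      = ∑ i ∈ Finset.range n, (Nat.digits 2 (c i)).sum := by
  induction n with
  | zero => intro c _; simp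
  | succ n ih =>
    intro c h
    rw [Finset.sum_range_succ', Finset.sum_range_succ', ← ih (fun i => c (i + 1))
      (fun i hi => h (i + 1) (by omega))]
    have e : ∑ i ∈ Finset.range n, c (i + 1) * (2 ^ s) ^ (i + 1)
        = 2 ^ s * ∑ i ∈ Finset.range n, c (i + 1) * (2 ^ s) ^ i := by
      rw [Finset.mul_sum]
      exact Finset.sum_congr rfl fun i _ => by ring
    rw [e, pow_zero, mul_one, add_comm, tm_block s _ _ (h 0 (by omega)), add_comm]

theorem tm_pow (s y j r : ℕ) (h : ∀ i < r + 1, y ^ i * j ^ (r - i) * r.choose i < 2 ^ s) :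
    (Nat.digits 2 ((y * 2 ^ s + j) ^ r)).sum
      = ∑ i ∈ Finset.range (r + 1), (Nat.digits 2 (y ^ i * j ^ (r - i) * r.choose i)).sum := by
  have e : (y * 2 ^ s + j) ^ r
      = ∑ i ∈ Finset.range (r + 1), (y ^ i * j ^ (r - i) * r.choose i) * (2 ^ s) ^ i := by
    rw [add_pow]
    refine Finset.sum_congr rfl fun i _ => ?_
    rw [mul_pow, Nat.cast_id]; ring
  rw [e]
  exact tm_sum s (r + 1) (fun i => y ^ i * j ^ (r - i) * r.choose i) h

theorem thueMorse_eq_for_lower_powers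
    (k : ℕ) (hk : 2 ≤ k) (m n y : ℕ) (hm : 0 < m) (hn : 0 < n) (hy : 0 < y)
    (hyle : y ≤ 2 ^ (2 * m + 2 * n + 1)) :
    ∃ N₀ : ℕ, ∀ N ≥ N₀, ∀ r : ℕ, 1 ≤ r → r ≤ k - 1 →
      ∀ j ≤ 2 ^ (Nat.floor ((1 + 1 / (2 * ((k : ℝ) - 1))) * N)),
        thueMorse ((y * 2 ^ (k * N - padicValNat 2 k) + j) ^ r) =
        thueMorse ((y * 2 ^ (k * N - padicValNat 2 k + 1) + j) ^ r) := by
  generalize 2 * m + 2 * n + 1 = P at hyle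
  generalize padicValNat 2 k = v
  refine ⟨2 * (P * k + k + v) + 1, fun N hN r hr hrk j hj => ?_⟩
  set F := Nat.floor ((1 + 1 / (2 * ((k : ℝ) - 1))) * N) with hF
  have hF2 : 2 * (F * (k - 1)) ≤ 2 * ((k - 1) * N) + N := by
    have hk1 : (0 : ℝ) < (k : ℝ) - 1 := by
      have : (2 : ℝ) ≤ k := by exact_mod_cast hk
      linarith
    have h1 : (F : ℝ) ≤ (1 + 1 / (2 * ((k : ℝ) - 1))) * N := Nat.floor_le (by positivity)
    have h2 : 2 * ((F : ℝ) * ((k : ℝ) - 1)) ≤ 2 * (((k : ℝ) - 1) * N) + N := by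
      calc 2 * ((F : ℝ) * ((k : ℝ) - 1))
          ≤ 2 * (((1 + 1 / (2 * ((k : ℝ) - 1))) * N) * ((k : ℝ) - 1)) := by gcongr
        _ = _ := by field_simp
    have h3 : ((k - 1 : ℕ) : ℝ) = (k : ℝ) - 1 := by
      rw [Nat.cast_sub (by omega)]; simp
    rw [← h3] at h2
    exact_mod_cast h2
  clear_value F
  have hexp : P * k + F * (k - 1) + k < k * N - v := by
    have : k * N = (k - 1) * N + N := by
      obtain ⟨q, rfl⟩ : ∃ q, k = q + 1 := ⟨k - 1, by omega⟩
      simp; ring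
    omega
  have key : ∀ i < r + 1, y ^ i * j ^ (r - i) * r.choose i < 2 ^ (k * N - v) := by
    intro i hi
    have a1 : y ^ i ≤ 2 ^ (P * k) := by
      calc y ^ i ≤ (2 ^ P) ^ i := Nat.pow_le_pow_left hyle i
        _ ≤ (2 ^ P) ^ k := Nat.pow_le_pow_right (by positivity) (by omega)
        _ = _ := by rw [pow_mul]
    have a2 : j ^ (r - i) ≤ 2 ^ (F * (k - 1)) := by
      calc j ^ (r - i) ≤ (2 ^ F) ^ (r - i) := Nat.pow_le_pow_left hj _
        _ ≤ (2 ^ F) ^ (k - 1) := Nat.pow_le_pow_right (by positivity) (by omega)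
        _ = _ := by rw [pow_mul]
    have a3 : r.choose i ≤ 2 ^ k :=
      (Nat.choose_le_two_pow r i).trans (Nat.pow_le_pow_right (by norm_num) (by omega))
    calc _ ≤ 2 ^ (P * k) * 2 ^ (F * (k - 1)) * 2 ^ k := by gcongr
      _ = 2 ^ (P * k + F * (k - 1) + k) := by rw [pow_add, pow_add]
      _ < _ := Nat.pow_lt_pow_right (by norm_num) hexp
  unfold thueMorse
  rw [tm_pow _ y j r key, tm_pow _ y j r (fun i hi => (key i hi).trans
    (Nat.pow_lt_pow_right (by norm_num) (by omega)))]
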